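/- arXiv:1808.01854 — 3 statements merged into one kernel-verified Lean document; each statement's English description precedes it below -/
import Mathlib

section
/- Let E be a finite-dimensional real inner product space, let x ∈ E, and let u, v : E → ℝ with u twice continuously differentiable and strictly positive on a neighborhood of x. Let κ ≥ 0 and δ > 0. If Δu(x) ≥ κ·u(x)² + ‖∇u(x)‖²/u(x) − v(x)·u(x), then Δ(fun y ↦ log(u(y) + δ))(x) ≥ κ·u(x)²/(u(x) + δ) − v(x)·u(x)/(u(x) + δ). -/
open Real

/-- The Laplacian of a real-valued function on a finite-dimensional real inner
product space: the trace of the second derivative, computed in an orthonormal basis. -/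
noncomputable def laplacian {E : Type*} [NormedAddCommGroup E] [InnerProductSpace ℝ E]
    [FiniteDimensional ℝ E] (f : E → ℝ) (x : E) : ℝ :=
  ∑ i, fderiv ℝ (fderiv ℝ f) x (stdOrthonormalBasis ℝ E i) (stdOrthonormalBasis ℝ E i)

theorem stmt1 {E : Type*} [NormedAddCommGroup E] [InnerProductSpace ℝ E]
    [FiniteDimensional ℝ E] (x : E) (u v : E → ℝ)
    (hu : ∃ s ∈ nhds x, ContDiffOn ℝ 2 u s ∧ ∀ y ∈ s, 0 < u y)
    (κ δ : ℝ) (hκ : 0 ≤ κ) (hδ : 0 < δ)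
    (h : κ * (u x) ^ 2 + ‖gradient u x‖ ^ 2 / u x - v x * u x ≤ laplacian u x) :
    κ * (u x) ^ 2 / (u x + δ) - v x * u x / (u x + δ) ≤
      laplacian (fun y => Real.log (u y + δ)) x := by
  obtain ⟨s, hs, hcs, hpos⟩ := hu
  have hc : ContDiffAt ℝ 2 u x := hcs.contDiffAt hs
  have hx : 0 < u x := hpos x (mem_of_mem_nhds hs)
  have hxd : 0 < u x + δ := by linarith
  have hev : fderiv ℝ (fun y => Real.log (u y + δ)) =ᶠ[nhds x]
      fun y => (u y + δ)⁻¹ • fderiv ℝ u y := by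
    filter_upwards [eventually_mem_nhds_iff.mpr hs] with y hy
    have hd : DifferentiableAt ℝ u y := (hcs.contDiffAt hy).differentiableAt (by norm_num)
    have hp := hpos y (mem_of_mem_nhds hy)
    exact ((hd.hasFDerivAt.add_const δ).log (by linarith)).fderiv
  have hd : DifferentiableAt ℝ u x := hc.differentiableAt (by norm_num)
  have hd2 : DifferentiableAt ℝ (fderiv ℝ u) x :=
    (hc.fderiv_right (m := 1) (by norm_num)).differentiableAt (by norm_num)
  have hinv : HasFDerivAt (fun y => (u y + δ)⁻¹) (-((u x + δ) ^ 2)⁻¹ • fderiv ℝ u x) x :=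
    (hasDerivAt_inv hxd.ne').comp_hasFDerivAt x (hd.hasFDerivAt.add_const δ)
  have hG : ‖gradient u x‖ ^ 2 = ∑ i, (fderiv ℝ u x (stdOrthonormalBasis ℝ E i)) ^ 2 := by
    rw [← (stdOrthonormalBasis ℝ E).sum_sq_norm_inner_left (gradient u x)]
    refine Finset.sum_congr rfl fun i _ => ?_
    rw [inner_gradient_left, Real.norm_eq_abs, sq_abs]
  have hL : laplacian (fun y => Real.log (u y + δ)) x
      = (u x + δ)⁻¹ * laplacian u x - ((u x + δ) ^ 2)⁻¹ * ‖gradient u x‖ ^ 2 := by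
    rw [hG]
    unfold laplacian
    rw [hev.fderiv_eq, (hinv.fun_smul hd2.hasFDerivAt).fderiv, Finset.mul_sum, Finset.mul_sum,
      ← Finset.sum_sub_distrib]
    refine Finset.sum_congr rfl fun i _ => ?_
    simp
    ring
  have hGG : ‖gradient u x‖ ^ 2 / (u x + δ) ≤ ‖gradient u x‖ ^ 2 / u x := by
    gcongr
    linarith
  have key : κ * (u x) ^ 2 - v x * u x ≤ laplacian u x - ‖gradient u x‖ ^ 2 / (u x + δ) := by
    linarith
  rw [hL]
  calc _ = (κ * (u x) ^ 2 - v x * u x) / (u x + δ) := by ring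
    _ ≤ (laplacian u x - ‖gradient u x‖ ^ 2 / (u x + δ)) / (u x + δ) := by gcongr
    _ = _ := by field_simp
end

section
/- Let (X, μ) be a finite measure space with μ(X) > 0, and let w : X → ℝ be a measurable function with 0 < w ≤ 1 everywhere and with 1/w integrable. Let S be a family of integrable functions f : X → ℝ with f ≤ 0 μ-almost everywhere, such that S is relatively compact in L¹(μ). Then there exists a constant C ≥ 1 such that for every f ∈ S and every b ∈ [0, 1/2]: 1/C ≤ ∫ exp(f(x))·w(x)^{−2b} dμ(x) ≤ C. -/
open MeasureTheory Real

theorem stmt5 {X : Type*} [MeasurableSpace X] (μ : Measure X) [IsFiniteMeasure μ]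
    (hμ : 0 < μ Set.univ)
    (w : X → ℝ) (hw : Measurable w) (hw0 : ∀ x, 0 < w x) (hw1 : ∀ x, w x ≤ 1)
    (hwint : Integrable (fun x => 1 / w x) μ)
    (S : Set (Lp ℝ 1 μ)) (hScpt : IsCompact (closure S))
    (hSneg : ∀ f ∈ S, ∀ᵐ x ∂μ, (f : X → ℝ) x ≤ 0) :
    ∃ C : ℝ, 1 ≤ C ∧ ∀ f ∈ S, ∀ b ∈ Set.Icc (0 : ℝ) (1 / 2),
      1 / C ≤ ∫ x, Real.exp ((f : X → ℝ) x) * w x ^ (-(2 * b)) ∂μ ∧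
        ∫ x, Real.exp ((f : X → ℝ) x) * w x ^ (-(2 * b)) ∂μ ≤ C := by
  obtain ⟨R, hR⟩ := hScpt.isBounded.exists_norm_le
  set m : ℝ := μ.real Set.univ with hm
  have hmpos : 0 < m := by
    rw [hm, measureReal_def]
    exact ENNReal.toReal_pos hμ.ne' (measure_ne_top _ _)
  set I : ℝ := ∫ x, 1 / w x ∂μ with hI
  set L : ℝ := Real.exp (-(R / m)) * m with hL
  have hLpos : 0 < L := mul_pos (Real.exp_pos _) hmpos
  refine ⟨max 1 (max I (1 / L)), le_max_left _ _, ?_⟩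
  intro f hf b hb
  obtain ⟨hb0, hb1⟩ := hb
  have hfint : Integrable (f : X → ℝ) μ := L1.integrable_coeFn f
  have hlow : ∀ x, 1 ≤ w x ^ (-(2 * b)) := fun x =>
    Real.one_le_rpow_of_pos_of_le_one_of_nonpos (hw0 x) (hw1 x) (by linarith)
  have hup : ∀ x, w x ^ (-(2 * b)) ≤ 1 / w x := fun x => by
    have h := Real.rpow_le_rpow_of_exponent_ge (hw0 x) (hw1 x)
      (show (-1 : ℝ) ≤ -(2 * b) by linarith)
    rwa [Real.rpow_neg_one, ← one_div] at h
  have hle : ∀ᵐ x ∂μ, Real.exp ((f : X → ℝ) x) * w x ^ (-(2 * b)) ≤ 1 / w x := by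
    filter_upwards [hSneg f hf] with x hx
    have h1 : Real.exp ((f : X → ℝ) x) ≤ 1 := Real.exp_le_one_iff.mpr hx
    have h2 := hlow x
    nlinarith [hup x]
  have hint : Integrable (fun x => Real.exp ((f : X → ℝ) x) * w x ^ (-(2 * b))) μ := by
    refine hwint.mono' ?_ ?_
    · exact ((Real.measurable_exp.comp_aemeasurable hfint.aemeasurable).mul
        (hw.pow_const _).aemeasurable).aestronglyMeasurable
    · filter_upwards [hle] with x hx
      rw [Real.norm_of_nonneg
        (mul_nonneg (Real.exp_pos _).le (Real.rpow_nonneg (hw0 x).le _))]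
      exact hx
  have hnorm : -R ≤ ∫ x, (f : X → ℝ) x ∂μ := by
    have h1 := hR f (subset_closure hf)
    rw [L1.norm_eq_integral_norm] at h1
    have h2 := norm_integral_le_integral_norm (μ := μ) (f : X → ℝ)
    rw [Real.norm_eq_abs] at h2
    linarith [neg_abs_le (∫ x, (f : X → ℝ) x ∂μ)]
  have hL1 : L ≤ ∫ x, Real.exp ((f : X → ℝ) x) * w x ^ (-(2 * b)) ∂μ := by
    calc L ≤ ∫ x, Real.exp (-(R / m)) * ((f : X → ℝ) x + (R / m + 1)) ∂μ := by
          rw [integral_const_mul, integral_add hfint (integrable_const _), integral_const,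
            smul_eq_mul, ← hm, hL]
          refine mul_le_mul_of_nonneg_left ?_ (Real.exp_pos _).le
          have : m * (R / m + 1) = R + m := by field_simp
          linarith
      _ ≤ _ := by
          refine integral_mono ((hfint.add (integrable_const _)).const_mul _) hint ?_
          intro x
          have h1 := Real.add_one_le_exp ((f : X → ℝ) x + R / m)
          have h2 : Real.exp ((f : X → ℝ) x)
              = Real.exp (-(R / m)) * Real.exp ((f : X → ℝ) x + R / m) := by
            rw [← Real.exp_add]; congr 1; ring
          have h3 : Real.exp (-(R / m)) * ((f : X → ℝ) x + (R / m + 1))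
              ≤ Real.exp ((f : X → ℝ) x) := by
            rw [h2]
            exact mul_le_mul_of_nonneg_left (by linarith) (Real.exp_pos _).le
          exact h3.trans (le_mul_of_one_le_right (Real.exp_pos _).le (hlow x))
  constructor
  · refine le_trans ?_ hL1
    rw [one_div_le (by positivity) hLpos]
    exact (le_max_right _ _).trans (le_max_right _ _)
  · exact (integral_mono_ae hint hwint hle).trans
      ((le_max_left _ _).trans (le_max_right _ _))
end

section
/- Let κ > 0. There is no twice continuously differentiable function h : ℂ → ℝ (ℂ viewed as a two-dimensional real inner product space) such that h is bounded above and Δh(z) ≥ κ · exp(h(z)) for every z ∈ ℂ. -/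
open Real

lemma second_deriv_bound (h : ℂ → ℝ) (hc : ContDiff ℝ 2 h) (ε : ℝ) (z e : ℂ) (he : ‖e‖ = 1)
    (hmax : ∀ w, h w - ε * ‖w‖ ^ 2 ≤ h z - ε * ‖z‖ ^ 2) :
    fderiv ℝ (fderiv ℝ h) z e e ≤ 2 * ε := by
  by_contra! hlt
  let p : ℝ → ℝ := fun t => h (z + t • e) - ε * (‖z‖ ^ 2 + 2 * t * inner ℝ z e + t ^ 2)
  have hp : ∀ t, p t = h (z + t • e) - ε * ‖z + t • e‖ ^ 2 := by
    intro t
    simp only [p]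
    rw [norm_add_sq_real, norm_smul, he, inner_smul_right]
    simp only [Real.norm_eq_abs, mul_one, sq_abs]
    ring
  have hline : ∀ t : ℝ, HasDerivAt (fun t : ℝ => z + t • e) e t := by
    intro t
    simpa using ((hasDerivAt_id t).smul_const e).const_add z
  have hd1 : ∀ t, HasDerivAt p
      (fderiv ℝ h (z + t • e) e - ε * (2 * inner ℝ z e + 2 * t)) t := by
    intro t
    have h1 : HasDerivAt (fun t : ℝ => h (z + t • e)) (fderiv ℝ h (z + t • e) e) t :=
      ((hc.differentiable (by norm_num)) (z + t • e)).hasFDerivAt.comp_hasDerivAt t (hline t)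
    have h2 : HasDerivAt (fun t : ℝ => ‖z‖ ^ 2 + 2 * t * inner ℝ z e + t ^ 2)
        (2 * inner ℝ z e + 2 * t) t := by
      have a := (((hasDerivAt_id t).const_mul 2).mul_const (inner ℝ z e)).const_add (‖z‖ ^ 2)
      have b := hasDerivAt_pow 2 t
      refine (a.add b).congr_deriv ?_
      norm_num
    exact h1.sub (h2.const_mul ε)
  have hder : deriv p = fun t => fderiv ℝ h (z + t • e) e - ε * (2 * inner ℝ z e + 2 * t) :=
    funext fun t => (hd1 t).deriv
  have hd2 : HasDerivAt (deriv p) (fderiv ℝ (fderiv ℝ h) z e e - ε * 2) 0 := by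
    rw [hder]
    have hdd : Differentiable ℝ (fderiv ℝ h) :=
      (hc.fderiv_right (m := 1) (by norm_num)).differentiable (by norm_num)
    have h1 : HasDerivAt (fun t : ℝ => fderiv ℝ h (z + t • e))
        (fderiv ℝ (fderiv ℝ h) (z + (0 : ℝ) • e) e) 0 :=
      (hdd (z + (0 : ℝ) • e)).hasFDerivAt.comp_hasDerivAt 0 (hline 0)
    have h1' := h1.clm_apply (hasDerivAt_const (0 : ℝ) e)
    have h2 : HasDerivAt (fun t : ℝ => 2 * inner ℝ z e + 2 * t) 2 0 := by
      simpa using ((hasDerivAt_id (0 : ℝ)).const_mul 2).const_add (2 * inner ℝ z e)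
    refine (h1'.sub (h2.const_mul ε)).congr_deriv ?_
    simp
  have hM : IsLocalMax p 0 := Filter.Eventually.of_forall fun t => by
    rw [hp, hp]
    simpa using hmax (z + t • e)
  have hm : IsLocalMin p 0 := by
    apply isLocalMin_of_deriv_deriv_pos
    · rw [hd2.deriv]; linarith
    · exact hM.deriv_eq_zero
    · exact (hd1 0).continuousAt
  have hcst : p =ᶠ[nhds 0] fun _ => p 0 := by
    filter_upwards [hM, hm] with t a b using le_antisymm a b
  have h0 : deriv (deriv p) 0 = 0 := by
    rw [hcst.deriv.deriv_eq]; simp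
  rw [hd2.deriv] at h0
  linarith

theorem stmt10 (κ : ℝ) (hκ : 0 < κ) :
    ¬ ∃ h : ℂ → ℝ, ContDiff ℝ 2 h ∧ BddAbove (Set.range h) ∧
      ∀ z : ℂ, κ * Real.exp (h z) ≤ laplacian h z := by
  rintro ⟨h, hc, ⟨B, hB⟩, hL⟩
  have hpos : 0 < κ * Real.exp (h 0) := by positivity
  obtain ⟨ε, hε⟩ : ∃ ε, ε = κ * Real.exp (h 0) / 8 := ⟨_, rfl⟩
  have hε0 : 0 < ε := by rw [hε]; positivity
  have hcont : Continuous fun w : ℂ => h w - ε * ‖w‖ ^ 2 := by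
    have := hc.continuous
    fun_prop
  have htend : Filter.Tendsto (fun w : ℂ => h w - ε * ‖w‖ ^ 2) (Filter.cocompact ℂ)
      Filter.atBot := by
    have h1 : Filter.Tendsto (fun w : ℂ => ε * ‖w‖ ^ 2) (Filter.cocompact ℂ) Filter.atTop :=
      ((Filter.tendsto_pow_atTop (two_ne_zero)).comp
        (tendsto_norm_cocompact_atTop)).const_mul_atTop hε0
    have h2 := Filter.tendsto_atBot_add_const_left _ B (Filter.tendsto_neg_atTop_atBot.comp h1)
    refine Filter.tendsto_atBot_mono (fun w => ?_) h2
    have := hB (Set.mem_range_self w)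
    simp only [Function.comp]
    linarith
  obtain ⟨z, hz⟩ := hcont.exists_forall_ge htend
  have hz0 : h 0 ≤ h z := by
    have := hz 0
    have h3 : 0 ≤ ε * ‖z‖ ^ 2 := by positivity
    simp at this
    linarith
  have hlap : laplacian h z ≤ 4 * ε := by
    unfold laplacian
    calc _ ≤ ∑ i : Fin (Module.finrank ℝ ℂ), 2 * ε := Finset.sum_le_sum fun i _ =>
          second_deriv_bound h hc ε z _ ((stdOrthonormalBasis ℝ ℂ).orthonormal.1 i) hz
      _ = 4 * ε := by
          simp [Complex.finrank_real_complex]; ring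
  have h5 : κ * Real.exp (h 0) ≤ κ * Real.exp (h z) := by gcongr
  have := hL z
  linarith
end
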